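/- Let Φ = Σ_{k=1}^∞ λ_k u_k ∧ v_k be a canonical form of a normalized Φ ∈ h∧h, let λ_max := max_k λ_k, let B = Σ_{k=1}^∞ λ_k c_{k,↓} c_{k,↑}, let Ψ_M = (B*)^M Ω, and suppose Ψ_M ≠ 0 and M·λ_max² ≤ 1/2. Then the normalized state Ψ̂_M := ‖Ψ_M‖^{-1} Ψ_M ∈ ⋀^{2M} h satisfies ⟨Φ, γ₂^{Ψ̂_M} Φ⟩ ≥ 2M·(1 − (M−1)·Σ_{k=1}^∞ λ_k⁴ − 2·M²·λ_max⁴). -/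

import Mathlib

/- Setting: `H` is the one-particle Hilbert space `h`, `F` is the fermionic Fock space over
`h` (carrying annihilation operators `an f = c(f)` satisfying the CAR, with adjoints the
creation operators `c*(f)`, and vacuum `Ω`), and `T` is the two-particle space `h ⊗ h`
(realized by a bilinear map `tp`, with the antisymmetric tensors `h ∧ h` inside it). -/

open scoped ComplexOrder

notation "⟪" x ", " y "⟫_ℂ" => @inner ℂ _ _ x y
open ContinuousLinearMap

noncomputable section

/-- A family of annihilation operators `an f = c(f)` on a Fock space `F` satisfying the
canonical anticommutation relations `{c(f), c(g)} = 0` and `{c(f), c*(g)} = ⟪f, g⟫ • 1`. -/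
def SatisfiesCAR {H F : Type*} [NormedAddCommGroup H] [InnerProductSpace ℂ H]
    [NormedAddCommGroup F] [InnerProductSpace ℂ F] [CompleteSpace F]
    (an : H → F →L[ℂ] F) : Prop :=
  (∀ f g : H, an f ∘L an g + an g ∘L an f = 0) ∧
  (∀ f g : H, an f ∘L adjoint (an g) + adjoint (an g) ∘L an f = ⟪f, g⟫_ℂ • (1 : F →L[ℂ] F))

/-- The action of `B = ∑ₖ λₖ c_{k,↓} c_{k,↑}` (where `c_{k,↑} = an (u k)` and
`c_{k,↓} = an (v k)`) on a vector of the Fock space. -/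
def applyB {H F : Type*} [NormedAddCommGroup F] [InnerProductSpace ℂ F]
    (an : H → F →L[ℂ] F) (u v : ℕ → H) (lam : ℕ → ℝ) (ψ : F) : F :=
  ∑' k : ℕ, (lam k : ℂ) • an (v k) (an (u k) ψ)

/-- The action of `B* = ∑ₖ λₖ c*_{k,↑} c*_{k,↓}` on a vector of the Fock space. -/
def applyBd {H F : Type*} [NormedAddCommGroup F] [InnerProductSpace ℂ F] [CompleteSpace F]
    (an : H → F →L[ℂ] F) (u v : ℕ → H) (lam : ℕ → ℝ) (ψ : F) : F :=
  ∑' k : ℕ, (lam k : ℂ) • adjoint (an (u k)) (adjoint (an (v k)) ψ)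

/-- `ψ` belongs to the `N`-particle sector `⋀^N h` of the Fock space, i.e. `ψ` is an
eigenvector of the number operator `𝒩 = ∑ₖ (c*_{k,↑} c_{k,↑} + c*_{k,↓} c_{k,↓})` with
eigenvalue `N` (here the `u k` and `v k` jointly form an orthonormal basis of `h`). -/
def InSector {H F : Type*} [NormedAddCommGroup F] [InnerProductSpace ℂ F] [CompleteSpace F]
    (an : H → F →L[ℂ] F) (u v : ℕ → H) (N : ℕ) (ψ : F) : Prop :=
  ∑' k : ℕ, (adjoint (an (u k)) (an (u k) ψ) + adjoint (an (v k)) (an (v k) ψ)) = (N : ℂ) • ψ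

/-- `Ω` is the (normalized) vacuum vector: it is annihilated by every `an f`. -/
def IsVacuum {H F : Type*} [NormedAddCommGroup F] [InnerProductSpace ℂ F]
    (an : H → F →L[ℂ] F) (Ω : F) : Prop :=
  ‖Ω‖ = 1 ∧ ∀ f : H, an f Ω = 0

/-- The trial states `Ψ_M = (B*)^M Ω`. -/
def PsiM {H F : Type*} [NormedAddCommGroup F] [InnerProductSpace ℂ F] [CompleteSpace F]
    (an : H → F →L[ℂ] F) (u v : ℕ → H) (lam : ℕ → ℝ) (Ω : F) : ℕ → F
  | 0 => Ω
  | M + 1 => applyBd an u v lam (PsiM an u v lam Ω M)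

/-- `tp` realizes the Hilbert space `T` as the Hilbert tensor product `h ⊗ h`: inner
products of elementary tensors multiply, and elementary tensors span a dense subspace. -/
def IsHilbertTensorProduct {H T : Type*} [NormedAddCommGroup H] [InnerProductSpace ℂ H]
    [NormedAddCommGroup T] [InnerProductSpace ℂ T]
    (tp : H →ₗ[ℂ] H →ₗ[ℂ] T) : Prop :=
  (∀ x y z w : H, ⟪tp x y, tp z w⟫_ℂ = ⟪x, z⟫_ℂ * ⟪y, w⟫_ℂ) ∧
  (Submodule.span ℂ {t : T | ∃ x y : H, t = tp x y}).topologicalClosure = ⊤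

/-- The elementary antisymmetric tensor `x ∧ y = (x ⊗ y - y ⊗ x)/√2`. -/
def wedgeVec {H T : Type*} [NormedAddCommGroup H] [InnerProductSpace ℂ H]
    [NormedAddCommGroup T] [InnerProductSpace ℂ T]
    (tp : H →ₗ[ℂ] H →ₗ[ℂ] T) (x y : H) : T :=
  (((Real.sqrt 2 : ℝ) : ℂ))⁻¹ • (tp x y - tp y x)

/-- `Φ = ∑ₖ λₖ • (u k) ∧ (v k)` is a canonical form of `Φ ∈ h ∧ h`: the sequences
`(u k)` and `(v k)` are jointly orthonormal and jointly span `h`, `λₖ ≥ 0` and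
`∑ₖ λₖ² = 1`. -/
def CanonicalWedgeForm {H T : Type*} [NormedAddCommGroup H] [InnerProductSpace ℂ H]
    [NormedAddCommGroup T] [InnerProductSpace ℂ T]
    (tp : H →ₗ[ℂ] H →ₗ[ℂ] T) (u v : ℕ → H) (lam : ℕ → ℝ) (Φ : T) : Prop :=
  Orthonormal ℂ (Sum.elim u v) ∧
  (Submodule.span ℂ (Set.range u ∪ Set.range v)).topologicalClosure = ⊤ ∧
  (∀ k, 0 ≤ lam k) ∧ (∑' k : ℕ, lam k ^ 2) = 1 ∧
  Φ = ∑' k : ℕ, (lam k : ℂ) • wedgeVec tp (u k) (v k)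

/-- `G` is the two-body operator `γ₂^Ψ` associated with the state `Ψ`, characterized by
`⟪φ₁ ⊗ φ₂, G (ψ₁ ⊗ ψ₂)⟫ = ⟪Ψ, c*(ψ₁) c*(ψ₂) c(φ₂) c(φ₁) Ψ⟫`. -/
def IsTwoBodyOp {H F T : Type*} [NormedAddCommGroup H] [InnerProductSpace ℂ H]
    [NormedAddCommGroup F] [InnerProductSpace ℂ F] [CompleteSpace F]
    [NormedAddCommGroup T] [InnerProductSpace ℂ T]
    (tp : H →ₗ[ℂ] H →ₗ[ℂ] T) (an : H → F →L[ℂ] F) (Ψ : F) (G : T →L[ℂ] T) : Prop :=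
  ∀ p q r s : H,
    ⟪tp p q, G (tp r s)⟫_ℂ = ⟪Ψ, adjoint (an r) (adjoint (an s) (an q (an p Ψ)))⟫_ℂ



section helpers
variable {H F T : Type*} [NormedAddCommGroup H] [InnerProductSpace ℂ H]
    [NormedAddCommGroup F] [InnerProductSpace ℂ F] [CompleteSpace F]
    [NormedAddCommGroup T] [InnerProductSpace ℂ T]

lemma _root_.HasSum.congr_fun' {f g : ℕ → ℝ} {c : ℝ} (h : HasSum f c) (e : ∀ k, g k = f k) :
    HasSum g c := by
  have : g = f := funext e
  rwa [this]

lemma car_aa {an : H → F →L[ℂ] F} (h : SatisfiesCAR an) (f g : H) (x : F) :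
    an f (an g x) = - an g (an f x) := by
  have := congrArg (fun A : F →L[ℂ] F => A x) (h.1 f g)
  simp at this
  exact eq_neg_of_add_eq_zero_left this

lemma car_cc {an : H → F →L[ℂ] F} (h : SatisfiesCAR an) (f g : H) (x : F) :
    adjoint (an f) (adjoint (an g) x) = - adjoint (an g) (adjoint (an f) x) := by
  apply ext_inner_right ℂ
  intro y
  rw [inner_neg_left, adjoint_inner_left, adjoint_inner_left, adjoint_inner_left,
    adjoint_inner_left, car_aa h g f, inner_neg_right]

lemma car_ac {an : H → F →L[ℂ] F} (h : SatisfiesCAR an) (f g : H) (x : F) :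
    an f (adjoint (an g) x) = ⟪f, g⟫_ℂ • x - adjoint (an g) (an f x) := by
  have := congrArg (fun A : F →L[ℂ] F => A x) (h.2 f g)
  simp at this
  exact eq_sub_of_add_eq this

lemma norm_sq_cre {an : H → F →L[ℂ] F} (h : SatisfiesCAR an) (f : H) (hf : ‖f‖ = 1) (x : F) :
    ‖adjoint (an f) x‖ ^ 2 = ‖x‖ ^ 2 - ‖an f x‖ ^ 2 := by
  have h1 : ⟪adjoint (an f) x, adjoint (an f) x⟫_ℂ = ⟪x, x⟫_ℂ - ⟪an f x, an f x⟫_ℂ := by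
    rw [adjoint_inner_left, car_ac h, inner_sub_right, adjoint_inner_right,
      inner_self_eq_norm_sq_to_K (𝕜 := ℂ) f, hf]
    simp
  simp only [inner_self_eq_norm_sq_to_K] at h1
  exact_mod_cast h1

/-- term of `B*`. -/
def bt (an : H → F →L[ℂ] F) (u v : ℕ → H) (lam : ℕ → ℝ) (k : ℕ) (ψ : F) : F :=
  (lam k : ℂ) • adjoint (an (u k)) (adjoint (an (v k)) ψ)

lemma hs_cre {an : H → F →L[ℂ] F} (h : SatisfiesCAR an) {u v : ℕ → H} {lam : ℕ → ℝ}
    {ψ χ : F} (hs : HasSum (fun k => bt an u v lam k ψ) χ) (f : H) :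
    HasSum (fun k => bt an u v lam k (adjoint (an f) ψ)) (adjoint (an f) χ) := by
  have := hs.mapL (adjoint (an f))
  convert this using 2 with k
  simp only [bt, map_smul]
  rw [car_cc h (v k) f, map_neg, car_cc h (u k) f, neg_neg]

lemma hs_u {an : H → F →L[ℂ] F} (h : SatisfiesCAR an) {u v : ℕ → H} {lam : ℕ → ℝ}
    (ho : Orthonormal ℂ (Sum.elim u v))
    {ψ χ : F} (hs : HasSum (fun k => bt an u v lam k ψ) χ) (k : ℕ) :
    HasSum (fun l => bt an u v lam l (an (u k) ψ))
      (an (u k) χ - (lam k : ℂ) • adjoint (an (v k)) ψ) := by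
  have h1 := hs.mapL (an (u k))
  have h2 := hasSum_ite_eq k ((lam k : ℂ) • adjoint (an (v k)) ψ)
  convert h1.sub h2 using 2 with l
  have huv : ⟪u k, v l⟫_ℂ = 0 := ho.2 (i := Sum.inl k) (j := Sum.inr l) (by simp)
  have huu : ⟪u k, u l⟫_ℂ = if l = k then 1 else 0 := by
    have := orthonormal_iff_ite.1 ho (Sum.inl k) (Sum.inl l)
    simpa [eq_comm] using this
  simp only [bt, map_smul]
  rw [car_ac h, car_ac h, huv, huu]
  split_ifs with hl
  · subst hl; simp
  · simp

lemma hs_v {an : H → F →L[ℂ] F} (h : SatisfiesCAR an) {u v : ℕ → H} {lam : ℕ → ℝ}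
    (ho : Orthonormal ℂ (Sum.elim u v))
    {ψ χ : F} (hs : HasSum (fun k => bt an u v lam k ψ) χ) (k : ℕ) :
    HasSum (fun l => bt an u v lam l (an (v k) ψ))
      (an (v k) χ + (lam k : ℂ) • adjoint (an (u k)) ψ) := by
  have h1 := hs.mapL (an (v k))
  have h2 := hasSum_ite_eq k ((lam k : ℂ) • adjoint (an (u k)) ψ)
  convert h1.add h2 using 2 with l
  have huv : ⟪v k, u l⟫_ℂ = 0 := ho.2 (i := Sum.inr k) (j := Sum.inl l) (by simp)
  have huu : ⟪v k, v l⟫_ℂ = if l = k then 1 else 0 := by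
    have := orthonormal_iff_ite.1 ho (Sum.inr k) (Sum.inr l)
    simpa [eq_comm] using this
  simp only [bt, map_smul]
  rw [car_ac h, car_ac h, huv, huu]
  split_ifs with hl
  · subst hl; simp [smul_sub]
  · simp

lemma bt_smul {an : H → F →L[ℂ] F} {u v : ℕ → H} {lam : ℕ → ℝ} (k : ℕ) (c : ℂ) (ψ : F) :
    bt an u v lam k (c • ψ) = c • bt an u v lam k ψ := by
  simp only [bt, map_smul]; rw [smul_comm]

lemma hs_psi {an : H → F →L[ℂ] F} {u v : ℕ → H} {lam : ℕ → ℝ} {Ω : F} {m : ℕ}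
    (hne : PsiM an u v lam Ω (m + 1) ≠ 0) :
    HasSum (fun k => bt an u v lam k (PsiM an u v lam Ω m)) (PsiM an u v lam Ω (m + 1)) := by
  have : Summable (fun k => bt an u v lam k (PsiM an u v lam Ω m)) := by
    by_contra hc
    exact hne (tsum_eq_zero_of_not_summable hc)
  exact this.hasSum

lemma psi_ne_pred {an : H → F →L[ℂ] F} {u v : ℕ → H} {lam : ℕ → ℝ} {Ω : F} {m : ℕ}
    (hne : PsiM an u v lam Ω (m + 1) ≠ 0) : PsiM an u v lam Ω m ≠ 0 := by
  intro h0
  apply hne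
  simp [PsiM, applyBd, h0]

lemma an_u_psi {an : H → F →L[ℂ] F} (h : SatisfiesCAR an) {u v : ℕ → H} {lam : ℕ → ℝ}
    (ho : Orthonormal ℂ (Sum.elim u v)) {Ω : F} (hΩ : IsVacuum an Ω) (k m : ℕ)
    (hne : PsiM an u v lam Ω (m + 1) ≠ 0) :
    an (u k) (PsiM an u v lam Ω (m + 1)) =
      (((m : ℂ) + 1) * lam k) • adjoint (an (v k)) (PsiM an u v lam Ω m) := by
  induction m with
  | zero =>
    have h1 := hs_u h ho (hs_psi hne) k
    have h2 : PsiM an u v lam Ω 0 = Ω := rfl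
    rw [h2, hΩ.2] at h1
    simp only [bt, map_zero, smul_zero] at h1
    have := h1.unique hasSum_zero
    rw [sub_eq_zero] at this
    rw [h2, this]; simp
  | succ m ih =>
    have hp := psi_ne_pred hne
    have h1 := hs_u h ho (hs_psi hne) k
    rw [ih hp] at h1
    have h2 := (hs_cre h (hs_psi hp) (v k)).const_smul (((m : ℂ) + 1) * lam k)
    simp only [bt_smul] at h1
    have := h1.unique h2
    rw [sub_eq_iff_eq_add] at this
    rw [this, ← add_smul]
    push_cast; ring_nf

lemma an_v_psi {an : H → F →L[ℂ] F} (h : SatisfiesCAR an) {u v : ℕ → H} {lam : ℕ → ℝ}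
    (ho : Orthonormal ℂ (Sum.elim u v)) {Ω : F} (hΩ : IsVacuum an Ω) (k m : ℕ)
    (hne : PsiM an u v lam Ω (m + 1) ≠ 0) :
    an (v k) (PsiM an u v lam Ω (m + 1)) =
      (-(((m : ℂ) + 1) * lam k)) • adjoint (an (u k)) (PsiM an u v lam Ω m) := by
  induction m with
  | zero =>
    have h1 := hs_v h ho (hs_psi hne) k
    have h2 : PsiM an u v lam Ω 0 = Ω := rfl
    rw [h2, hΩ.2] at h1
    simp only [bt, map_zero, smul_zero] at h1
    have := h1.unique hasSum_zero
    rw [add_eq_zero_iff_eq_neg] at this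
    rw [h2, this]; simp
  | succ m ih =>
    have hp := psi_ne_pred hne
    have h1 := hs_v h ho (hs_psi hne) k
    rw [ih hp] at h1
    have h2 := (hs_cre h (hs_psi hp) (u k)).const_smul (-(((m : ℂ) + 1) * lam k))
    simp only [bt_smul] at h1
    have := h1.unique h2
    rw [← eq_sub_iff_add_eq] at this
    rw [this, ← sub_smul]
    push_cast; ring_nf

lemma sum_x {an : H → F →L[ℂ] F} (h : SatisfiesCAR an) {u v : ℕ → H} {lam : ℕ → ℝ}
    (ho : Orthonormal ℂ (Sum.elim u v)) {Ω : F} (hΩ : IsVacuum an Ω) (m : ℕ)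
    (hne : PsiM an u v lam Ω (m + 1) ≠ 0) :
    HasSum (fun k => ((m : ℝ) + 1) * (lam k ^ 2 * ‖adjoint (an (v k)) (PsiM an u v lam Ω m)‖ ^ 2))
      (‖PsiM an u v lam Ω (m + 1)‖ ^ 2) := by
  have h1 := (hs_psi hne).mapL (innerSL ℂ (PsiM an u v lam Ω (m + 1)))
  rw [← RCLike.hasSum_ofReal ℂ]
  convert h1 using 2 with k
  · simp only [bt, innerSL_apply_apply, inner_smul_right]
    rw [adjoint_inner_right, an_u_psi h ho hΩ k m hne, inner_smul_left, inner_self_eq_norm_sq_to_K]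
    simp; ring
  · simp only [innerSL_apply_apply]
    rw [inner_self_eq_norm_sq_to_K]; simp

lemma sum_y {an : H → F →L[ℂ] F} (h : SatisfiesCAR an) {u v : ℕ → H} {lam : ℕ → ℝ}
    (ho : Orthonormal ℂ (Sum.elim u v)) {Ω : F} (hΩ : IsVacuum an Ω) (m : ℕ)
    (hne : PsiM an u v lam Ω (m + 1) ≠ 0) :
    HasSum (fun k => ((m : ℝ) + 1) * (lam k ^ 2 * ‖adjoint (an (u k)) (PsiM an u v lam Ω m)‖ ^ 2))
      (‖PsiM an u v lam Ω (m + 1)‖ ^ 2) := by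
  have h1 := (hs_psi hne).mapL (innerSL ℂ (PsiM an u v lam Ω (m + 1)))
  rw [← RCLike.hasSum_ofReal ℂ]
  convert h1 using 2 with k
  · simp only [bt, innerSL_apply_apply, inner_smul_right]
    rw [car_cc h, inner_neg_right, adjoint_inner_right]
    rw [an_v_psi h ho hΩ k m hne, inner_smul_left, inner_self_eq_norm_sq_to_K]
    simp; ring
  · simp only [innerSL_apply_apply]
    rw [inner_self_eq_norm_sq_to_K]; simp

/-- recursion -/
lemma rec_norm {an : H → F →L[ℂ] F} (h : SatisfiesCAR an) {u v : ℕ → H} {lam : ℕ → ℝ}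
    (ho : Orthonormal ℂ (Sum.elim u v)) {Ω : F} (hΩ : IsVacuum an Ω) (m : ℕ)
    (hl : HasSum (fun k => lam k ^ 2) 1)
    (hne : PsiM an u v lam Ω (m + 2) ≠ 0) :
    HasSum (fun k => ((m : ℝ) + 2) * ((m : ℝ) + 1) ^ 2 *
      (lam k ^ 4 * ‖adjoint (an (u k)) (PsiM an u v lam Ω m)‖ ^ 2))
      (((m : ℝ) + 2) * ‖PsiM an u v lam Ω (m + 1)‖ ^ 2 - ‖PsiM an u v lam Ω (m + 2)‖ ^ 2) := by
  have h1 := sum_x h ho hΩ (m + 1) hne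
  have h2 := hl.mul_left (((m : ℝ) + 2) * ‖PsiM an u v lam Ω (m + 1)‖ ^ 2)
  rw [mul_one] at h2
  refine (h2.sub h1).congr_fun' fun k => ?_
  have hv : ‖v k‖ = 1 := ho.1 (Sum.inr k)
  rw [norm_sq_cre h _ hv, an_v_psi h ho hΩ k m (psi_ne_pred hne), norm_smul, norm_neg, norm_mul]
  have : ‖((m : ℂ) + 1)‖ = (m : ℝ) + 1 := by
    have : ((m : ℂ) + 1) = ((m + 1 : ℕ) : ℂ) := by push_cast; rfl
    rw [this, Complex.norm_natCast]; push_cast; rfl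
  rw [this, Complex.norm_real, mul_pow, mul_pow, Real.norm_eq_abs, sq_abs]
  push_cast; ring

lemma norm_one {an : H → F →L[ℂ] F} (h : SatisfiesCAR an) {u v : ℕ → H} {lam : ℕ → ℝ}
    (ho : Orthonormal ℂ (Sum.elim u v)) {Ω : F} (hΩ : IsVacuum an Ω)
    (hl : HasSum (fun k => lam k ^ 2) 1)
    (hne : PsiM an u v lam Ω 1 ≠ 0) :
    ‖PsiM an u v lam Ω 1‖ ^ 2 = ‖PsiM an u v lam Ω 0‖ ^ 2 := by
  have h1 := sum_x h ho hΩ 0 hne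
  have h2 := hl.mul_left (‖PsiM an u v lam Ω 0‖ ^ 2)
  rw [mul_one] at h2
  refine h1.unique (h2.congr_fun' fun k => ?_)
  have hv : ‖v k‖ = 1 := ho.1 (Sum.inr k)
  rw [norm_sq_cre h _ hv]
  have : PsiM an u v lam Ω 0 = Ω := rfl
  rw [this, hΩ.2]
  simp; ring

lemma step1 {an : H → F →L[ℂ] F} (h : SatisfiesCAR an) {u v : ℕ → H} {lam : ℕ → ℝ}
    (ho : Orthonormal ℂ (Sum.elim u v)) {Ω : F} (hΩ : IsVacuum an Ω) (m : ℕ)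
    (hl : HasSum (fun k => lam k ^ 2) 1) {a : ℝ} (ha : ∀ k, lam k ^ 2 ≤ a)
    (hne : PsiM an u v lam Ω (m + 1) ≠ 0) :
    ((m : ℝ) + 1) * (1 - m * a) * ‖PsiM an u v lam Ω m‖ ^ 2 ≤ ‖PsiM an u v lam Ω (m + 1)‖ ^ 2 := by
  cases m with
  | zero => rw [norm_one h ho hΩ hl hne]; simp
  | succ m =>
    have h1 := rec_norm h ho hΩ m hl hne
    have h2 := (sum_y h ho hΩ m (psi_ne_pred hne)).mul_left (((m : ℝ) + 2) * ((m : ℝ) + 1) * a)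
    have h3 := hasSum_le (fun k => ?_) h1 h2
    · push_cast
      have e : m + 1 + 1 = m + 2 := rfl
      rw [e]
      nlinarith
    · have : (0:ℝ) ≤ ((m : ℝ) + 2) * ((m : ℝ) + 1) ^ 2 *
          (lam k ^ 2 * ‖adjoint (an (u k)) (PsiM an u v lam Ω m)‖ ^ 2) := by positivity
      have := mul_le_mul_of_nonneg_left (ha k) this
      nlinarith

lemma step2 {an : H → F →L[ℂ] F} (h : SatisfiesCAR an) {u v : ℕ → H} {lam : ℕ → ℝ}
    (ho : Orthonormal ℂ (Sum.elim u v)) {Ω : F} (hΩ : IsVacuum an Ω) (m : ℕ)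
    (hl : HasSum (fun k => lam k ^ 2) 1) {p : ℝ} (hp : HasSum (fun k => lam k ^ 4) p)
    (hne : PsiM an u v lam Ω (m + 2) ≠ 0) :
    ((m : ℝ) + 2) * (‖PsiM an u v lam Ω (m + 1)‖ ^ 2
      - ((m : ℝ) + 1) ^ 2 * p * ‖PsiM an u v lam Ω m‖ ^ 2) ≤ ‖PsiM an u v lam Ω (m + 2)‖ ^ 2 := by
  have h1 := rec_norm h ho hΩ m hl hne
  have h2 := hp.mul_left (((m : ℝ) + 2) * ((m : ℝ) + 1) ^ 2 * ‖PsiM an u v lam Ω m‖ ^ 2)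
  have h3 := hasSum_le (fun k => ?_) h1 h2
  · linarith
  · have hu : ‖u k‖ = 1 := ho.1 (Sum.inl k)
    have h4 : ‖adjoint (an (u k)) (PsiM an u v lam Ω m)‖ ^ 2 ≤ ‖PsiM an u v lam Ω m‖ ^ 2 := by
      rw [norm_sq_cre h _ hu]; nlinarith [sq_nonneg ‖an (u k) (PsiM an u v lam Ω m)‖]
    have : (0:ℝ) ≤ ((m : ℝ) + 2) * ((m : ℝ) + 1) ^ 2 * lam k ^ 4 := by positivity
    have := mul_le_mul_of_nonneg_left h4 this
    linarith

lemma ratio {an : H → F →L[ℂ] F} (h : SatisfiesCAR an) {u v : ℕ → H} {lam : ℕ → ℝ}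
    (ho : Orthonormal ℂ (Sum.elim u v)) {Ω : F} (hΩ : IsVacuum an Ω) (m : ℕ)
    (hl : HasSum (fun k => lam k ^ 2) 1) {a : ℝ} (ha : ∀ k, lam k ^ 2 ≤ a)
    (hsm : ((m : ℝ) + 1) * a ≤ 1 / 2)
    (hne : PsiM an u v lam Ω (m + 1) ≠ 0) :
    ((m : ℝ) + 1) * (1 - m * (∑' k, lam k ^ 4) - 2 * ((m : ℝ) + 1) ^ 2 * a ^ 2)
      * ‖PsiM an u v lam Ω m‖ ^ 2 ≤ ‖PsiM an u v lam Ω (m + 1)‖ ^ 2 := by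
  have ha0 : 0 ≤ a := (sq_nonneg _).trans (ha 0)
  have h4 : ∀ k, lam k ^ 4 ≤ a * lam k ^ 2 := fun k => by
    nlinarith [mul_le_mul_of_nonneg_right (ha k) (sq_nonneg (lam k))]
  have hs : Summable (fun k => lam k ^ 4) :=
    Summable.of_nonneg_of_le (fun k => by positivity) h4 (hl.summable.mul_left a)
  have hpa : (∑' k, lam k ^ 4) ≤ a := by
    have := hasSum_le h4 hs.hasSum (hl.mul_left a)
    linarith
  have hp0 : 0 ≤ ∑' k, lam k ^ 4 := tsum_nonneg fun k => by positivity
  cases m with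
  | zero =>
    rw [norm_one h ho hΩ hl hne]
    have : 0 ≤ a ^ 2 * ‖PsiM an u v lam Ω 0‖ ^ 2 := by positivity
    simp; nlinarith
  | succ m =>
    have s2 := step2 h ho hΩ m hl hs.hasSum hne
    have s1 := step1 h ho hΩ m hl ha (psi_ne_pred hne)
    set p := ∑' k, lam k ^ 4
    have e : m + 1 + 1 = m + 2 := rfl
    rw [e]
    set x := ‖PsiM an u v lam Ω m‖ ^ 2
    set y := ‖PsiM an u v lam Ω (m + 1)‖ ^ 2
    set z := ‖PsiM an u v lam Ω (m + 2)‖ ^ 2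
    have hx : 0 ≤ x := by positivity
    have hy : 0 ≤ y := by positivity
    push_cast at hsm ⊢
    set n : ℝ := (m : ℝ)
    have hn : 0 ≤ n := Nat.cast_nonneg m
    -- (n+1) x ≤ (1+2na) y
    have hna : 0 ≤ n * a := by positivity
    have hna2 : n * a ≤ 1 / 2 := by nlinarith
    have q1 : (n + 1) * x ≤ (1 + 2 * (n * a)) * y := by
      have t1 := mul_le_mul_of_nonneg_left s1 (show 0 ≤ 1 + 2 * (n * a) by positivity)
      have t2 : 0 ≤ (n * a) * (1 - 2 * (n * a)) * ((n + 1) * x) := by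
        apply mul_nonneg (mul_nonneg hna (by linarith)) (by positivity)
      nlinarith
    have q2 : (n + 1) * p * ((n + 1) * x) ≤ (n + 1) * p * ((1 + 2 * (n * a)) * y) :=
      mul_le_mul_of_nonneg_left q1 (by positivity)
    have q3 : (n + 1) * p * ((1 + 2 * (n * a)) * y) ≤
        ((n + 1) * p + 2 * (n + 1 + 1) ^ 2 * a ^ 2) * y := by
      have t : p * (n * a) ≤ a * (n * a) := mul_le_mul_of_nonneg_right hpa hna
      have t3 : 2 * (n + 1) * (p * (n * a)) ≤ 2 * (n + 1 + 1) ^ 2 * a ^ 2 := by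
        have : 2 * (n + 1) * (p * (n * a)) ≤ 2 * (n + 1) * (a * (n * a)) :=
          mul_le_mul_of_nonneg_left t (by positivity)
        nlinarith [mul_nonneg hn (sq_nonneg a), sq_nonneg a]
      have := mul_le_mul_of_nonneg_right t3 hy
      nlinarith
    have q4 := mul_le_mul_of_nonneg_left (q2.trans q3) (show 0 ≤ n + 2 by positivity)
    nlinarith

lemma wedge_G {tp : H →ₗ[ℂ] H →ₗ[ℂ] T} {an : H → F →L[ℂ] F} (h : SatisfiesCAR an) {Ψ : F}
    {G : T →L[ℂ] T} (hG : IsTwoBodyOp tp an Ψ G) (x y z w : H) :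
    ⟪wedgeVec tp x y, G (wedgeVec tp z w)⟫_ℂ = 2 * ⟪an w (an z Ψ), an y (an x Ψ)⟫_ℂ := by
  have hG' : ∀ p q r s : H, ⟪tp p q, G (tp r s)⟫_ℂ = ⟪an s (an r Ψ), an q (an p Ψ)⟫_ℂ := by
    intro p q r s
    rw [hG, adjoint_inner_right, adjoint_inner_right]
  have hsq : ((Real.sqrt 2 : ℝ) : ℂ)⁻¹ * ((Real.sqrt 2 : ℝ) : ℂ)⁻¹ = 1 / 2 := by
    rw [← mul_inv, ← Complex.ofReal_mul, Real.mul_self_sqrt (by norm_num)]; norm_num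
  simp only [wedgeVec, map_smul, map_sub, inner_smul_left, inner_smul_right, inner_sub_left,
    inner_sub_right, hG']
  rw [car_aa h z w, car_aa h x y]
  simp only [inner_neg_left, inner_neg_right, map_inv₀, Complex.conj_ofReal]
  linear_combination (4 * ⟪an w (an z Ψ), an y (an x Ψ)⟫_ℂ) * hsq

lemma quad_G {tp : H →ₗ[ℂ] H →ₗ[ℂ] T} {an : H → F →L[ℂ] F} (h : SatisfiesCAR an) {Ψ : F}
    {G : T →L[ℂ] T} (hG : IsTwoBodyOp tp an Ψ G) (u v : ℕ → H) (lam : ℕ → ℝ) (K : Finset ℕ) :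
    ⟪∑ k ∈ K, (lam k : ℂ) • wedgeVec tp (u k) (v k),
      G (∑ k ∈ K, (lam k : ℂ) • wedgeVec tp (u k) (v k))⟫_ℂ =
    ((2 * ‖∑ k ∈ K, (lam k : ℂ) • an (v k) (an (u k) Ψ)‖ ^ 2 : ℝ) : ℂ) := by
  push_cast
  have : ((‖∑ k ∈ K, (lam k : ℂ) • an (v k) (an (u k) Ψ)‖ : ℂ)) ^ 2 =
    ⟪∑ k ∈ K, (lam k : ℂ) • an (v k) (an (u k) Ψ), ∑ k ∈ K, (lam k : ℂ) • an (v k) (an (u k) Ψ)⟫_ℂ := by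
    rw [inner_self_eq_norm_sq_to_K]; rfl
  rw [this]
  simp only [map_sum, map_smul, sum_inner, inner_sum, inner_smul_left, inner_smul_right,
    wedge_G h hG, Complex.conj_ofReal, Finset.mul_sum]
  rw [Finset.sum_comm]
  refine Finset.sum_congr rfl fun i _ => Finset.sum_congr rfl fun j _ => ?_
  ring

end helpers

/-- **Equation (33).** If `Ψ_M ≠ 0` and `M·λ_max² ≤ 1/2`, the normalized trial state
`Ψ̂_M = ‖Ψ_M‖⁻¹ Ψ_M` satisfies
`⟪Φ, γ₂^{Ψ̂_M} Φ⟫ ≥ 2M·(1 - (M-1)·∑ₖ λₖ⁴ - 2M²λ_max⁴)`. -/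
theorem trial_state_lower_bound
    {H F T : Type*} [NormedAddCommGroup H] [InnerProductSpace ℂ H] [CompleteSpace H]
    [NormedAddCommGroup F] [InnerProductSpace ℂ F] [CompleteSpace F]
    [NormedAddCommGroup T] [InnerProductSpace ℂ T] [CompleteSpace T]
    (an : H → F →L[ℂ] F) (hCAR : SatisfiesCAR an)
    (tp : H →ₗ[ℂ] H →ₗ[ℂ] T) (htp : IsHilbertTensorProduct tp)
    (u v : ℕ → H) (lam : ℕ → ℝ) (Φ : T) (hΦnorm : ‖Φ‖ = 1)
    (hΦ : CanonicalWedgeForm tp u v lam Φ)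
    (Ω : F) (hΩ : IsVacuum an Ω)
    (lamMax : ℝ) (hmax : IsGreatest (Set.range lam) lamMax)
    (M : ℕ) (hne : PsiM an u v lam Ω M ≠ 0)
    (hsmall : (M : ℝ) * lamMax ^ 2 ≤ 1 / 2) :
    ∀ G : T →L[ℂ] T,
      IsTwoBodyOp tp an ((‖PsiM an u v lam Ω M‖ : ℂ)⁻¹ • PsiM an u v lam Ω M) G →
        ((2 * (M : ℝ) * (1 - ((M : ℝ) - 1) * (∑' k : ℕ, lam k ^ 4)
            - 2 * (M : ℝ) ^ 2 * lamMax ^ 4) : ℝ) : ℂ) ≤ ⟪Φ, G Φ⟫_ℂ := by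
  intro G hG
  obtain ⟨ho, -, hl0, hl1, hΦe⟩ := hΦ
  have hl : HasSum (fun k => lam k ^ 2) 1 := by
    have : Summable (fun k => lam k ^ 2) := by
      by_contra hc
      rw [tsum_eq_zero_of_not_summable hc] at hl1
      exact zero_ne_one hl1
    rw [← hl1]; exact this.hasSum
  have hΦs : HasSum (fun k => (lam k : ℂ) • wedgeVec tp (u k) (v k)) Φ := by
    have : Summable (fun k => (lam k : ℂ) • wedgeVec tp (u k) (v k)) := by
      by_contra hc
      rw [tsum_eq_zero_of_not_summable hc] at hΦe
      rw [hΦe, norm_zero] at hΦnorm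
      exact zero_ne_one hΦnorm
    rw [hΦe]; exact this.hasSum
  set Ψ := PsiM an u v lam Ω M with hΨ
  set Ψh : F := (‖Ψ‖ : ℂ)⁻¹ • Ψ with hΨh
  have hlim : Filter.Tendsto (fun K : Finset ℕ =>
      ((2 * ‖∑ k ∈ K, (lam k : ℂ) • an (v k) (an (u k) Ψh)‖ ^ 2 : ℝ) : ℂ))
      Filter.atTop (nhds ⟪Φ, G Φ⟫_ℂ) := by
    simp only [← quad_G hCAR hG u v lam]
    have h1 : Filter.Tendsto (fun K : Finset ℕ => ∑ k ∈ K, (lam k : ℂ) • wedgeVec tp (u k) (v k))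
      Filter.atTop (nhds Φ) := hΦs
    exact h1.inner ((G.continuous.tendsto Φ).comp h1)
  have hre := (Complex.continuous_re.tendsto _).comp hlim
  have him := (Complex.continuous_im.tendsto _).comp hlim
  have him0 : (⟪Φ, G Φ⟫_ℂ).im = 0 := by
    refine tendsto_nhds_unique him ?_
    simp only [Function.comp_def, Complex.ofReal_im]
    exact tendsto_const_nhds
  simp only [Function.comp_def, Complex.ofReal_re] at hre
  rw [Complex.le_def]
  refine ⟨?_, by rw [Complex.ofReal_im, him0]⟩
  rw [Complex.ofReal_re]
  cases M with
  | zero =>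
    have : (0:ℝ) ≤ (⟪Φ, G Φ⟫_ℂ).re := ge_of_tendsto' hre fun K => by positivity
    simpa using this
  | succ m =>
    have hp := psi_ne_pred hne
    set χ := PsiM an u v lam Ω m with hχ
    have hΨ0 : 0 < ‖Ψ‖ := norm_pos_iff.2 hne
    have hχ0 : 0 < ‖χ‖ := norm_pos_iff.2 hp
    have ha : ∀ k, lam k ^ 2 ≤ lamMax ^ 2 := fun k =>
      pow_le_pow_left₀ (hl0 k) (hmax.2 ⟨k, rfl⟩) 2
    have hr := ratio hCAR ho hΩ m hl ha (by push_cast at hsmall; exact hsmall) hne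
    rw [← hΨ, ← hχ] at hr
    -- Cauchy-Schwarz
    have hs := (hs_psi hne).mapL (innerSL ℂ Ψh)
    have hs1 : Filter.Tendsto (fun K : Finset ℕ => ‖∑ k ∈ K, innerSL ℂ Ψh (bt an u v lam k χ)‖)
      Filter.atTop (nhds ‖innerSL ℂ Ψh Ψ‖) := hs.norm
    have hval : ‖innerSL ℂ Ψh Ψ‖ = ‖Ψ‖ := by
      rw [innerSL_apply_apply, hΨh, inner_smul_left, inner_self_eq_norm_sq_to_K]
      simp
      field_simp
    rw [hval] at hs1
    have hcs : ∀ K : Finset ℕ, ‖∑ k ∈ K, innerSL ℂ Ψh (bt an u v lam k χ)‖ ^ 2 * 2 ≤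
        (2 * ‖∑ k ∈ K, (lam k : ℂ) • an (v k) (an (u k) Ψh)‖ ^ 2) * ‖χ‖ ^ 2 := by
      intro K
      have : ∑ k ∈ K, innerSL ℂ Ψh (bt an u v lam k χ) =
          ⟪∑ k ∈ K, (lam k : ℂ) • an (v k) (an (u k) Ψh), χ⟫_ℂ := by
        simp only [sum_inner, innerSL_apply_apply, bt, inner_smul_left, inner_smul_right,
          adjoint_inner_right, Complex.conj_ofReal]
      rw [this]
      have := pow_le_pow_left₀ (norm_nonneg _) (norm_inner_le_norm (𝕜 := ℂ)
        (∑ k ∈ K, (lam k : ℂ) • an (v k) (an (u k) Ψh)) χ) 2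
      rw [mul_pow] at this
      linarith
    have hfin := le_of_tendsto_of_tendsto' ((hs1.pow 2).mul_const 2) (hre.mul_const (‖χ‖ ^ 2)) hcs
    have hχ2 : 0 < ‖χ‖ ^ 2 := by positivity
    refine le_of_mul_le_mul_right (le_trans ?_ hfin) hχ2
    push_cast
    have e4 : (lamMax ^ 2) ^ 2 = lamMax ^ 4 := by ring
    rw [e4] at hr
    linarith
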